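/- Let R be a commutative noetherian ring of finite Krull dimension, let p be a prime ideal of R, and let E = E(R/p) be an injective hull of the R-module R/p (an injective R-module containing R/p as an essential submodule, i.e., every nonzero submodule of E has nonzero intersection with R/p). Then for every prime ideal q of R, there exists i ≥ 0 with Ext^i_R(κ(q), E) ≠ 0 if and only if q ⊆ p; that is, the cosupport of E(R/p) is {q ∈ Spec(R) : q ⊆ p}. -/

import Mathlib

open CategoryTheory Opposite

universe u

/-- The cosupport of an `R`-module `M`, as a subset of `Spec R`: the primes `q` such
that `Ext^i_R(κ(q), M) ≠ 0` for some `i`, where `κ(q)` is the residue field of the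
localization `R_q`, regarded as an `R`-module. -/
noncomputable def moduleCosupport (R : Type u) [CommRing R] (M : Type u)
    [AddCommGroup M] [Module R M] : Set (PrimeSpectrum R) :=
  { q | ∃ i : ℕ, Nontrivial (((Ext R (ModuleCat.{u} R) i).obj
      (op (ModuleCat.of R (IsLocalRing.ResidueField (Localization.AtPrime q.asIdeal))))).obj
      (ModuleCat.of R M)) }

/-- Contravariant Hom into a fixed module sends colimits to limits. -/
instance preservesFiniteLimits_linearYoneda_obj (R : Type u) [CommRing R] (E : ModuleCat.{u} R) :
    Limits.PreservesFiniteLimits ((linearYoneda R (ModuleCat.{u} R)).obj E) := by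
  have : Limits.PreservesFiniteLimits
      ((linearYoneda R (ModuleCat.{u} R)).obj E ⋙ forget (ModuleCat.{u} R)) :=
    inferInstanceAs (Limits.PreservesFiniteLimits (yoneda.obj E))
  exact Limits.preservesFiniteLimits_of_reflects_of_preserves _ (forget (ModuleCat.{u} R))

/-- Higher Ext into an injective module vanishes. -/
lemma isZero_Ext_succ_of_injective {R : Type u} [CommRing R] (X E : ModuleCat.{u} R)
    [Injective E] (n : ℕ) :
    Limits.IsZero (((Ext R (ModuleCat.{u} R) (n + 1)).obj (op X)).obj E) := by
  let P := projectiveResolution X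
  refine Limits.IsZero.of_iso ?_ (P.isoExt (n + 1) E)
  rw [← HomologicalComplex.exactAt_iff_isZero_homology,
    HomologicalComplex.exactAt_iff' _ n (n + 1) (n + 2) (by simp) (by simp),
    ShortComplex.moduleCat_exact_iff]
  intro (f : P.complex.X (n + 1) ⟶ E) hf
  have hf' : P.complex.d (n + 2) (n + 1) ≫ f = 0 := hf
  exact ⟨(P.exact_succ n).descToInjective f hf', (P.exact_succ n).comp_descToInjective f hf'⟩

/-- `Ext⁰(X, E)` is `Hom(X, E)`. -/
noncomputable def extZeroIso {R : Type u} [CommRing R] (X E : ModuleCat.{u} R) :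
    ((Ext R (ModuleCat.{u} R) 0).obj (op X)).obj E ≅ ModuleCat.of R (X ⟶ E) :=
  haveI : Limits.PreservesFiniteColimits ((linearYoneda R (ModuleCat.{u} R)).obj E).rightOp :=
    Limits.preservesFiniteColimits_rightOp _
  (((linearYoneda R (ModuleCat.{u} R)).obj E).rightOp.leftDerivedZeroIsoSelf.app X).unop.symm

/-- The cosupport of an injective module is detected by `Hom` alone. -/
lemma mem_moduleCosupport_iff_of_injective {R : Type u} [CommRing R] (E : Type u)
    [AddCommGroup E] [Module R E] [Module.Injective R E] (q : PrimeSpectrum R) :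
    q ∈ moduleCosupport R E ↔
      ∃ f : IsLocalRing.ResidueField (Localization.AtPrime q.asIdeal) →ₗ[R] E, f ≠ 0 := by
  have : Injective (ModuleCat.of R E) := Module.injective_object_of_injective_module R E
  have h₀ := (extZeroIso (ModuleCat.of R
    (IsLocalRing.ResidueField (Localization.AtPrime q.asIdeal)))
      (ModuleCat.of R E)).toLinearEquiv.toEquiv.trans ModuleCat.homEquiv
  constructor
  · rintro ⟨_ | n, hn⟩
    · have := h₀.nontrivial_congr.mp hn
      exact exists_ne 0
    · have := ModuleCat.subsingleton_of_isZero (isZero_Ext_succ_of_injective (ModuleCat.of R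
        (IsLocalRing.ResidueField (Localization.AtPrime q.asIdeal))) (ModuleCat.of R E) n)
      exact (not_nontrivial _ hn).elim
  · rintro ⟨f, hf⟩
    exact ⟨0, h₀.nontrivial_congr.mpr ⟨f, 0, hf⟩⟩

/-- An element outside `p` acts injectively on an essential extension of `R ⧸ p`. -/
lemma eq_zero_of_smul_eq_zero_of_essential {R : Type*} [CommRing R] {p : Ideal R} [p.IsPrime]
    {E : Type*} [AddCommGroup E] [Module R E] (ι : (R ⧸ p) →ₗ[R] E)
    (hι : Function.Injective ι)
    (hess : ∀ N : Submodule R E, N ≠ ⊥ → N ⊓ LinearMap.range ι ≠ ⊥)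
    {s : R} (hs : s ∉ p) {x : E} (hx : s • x = 0) : x = 0 := by
  have hker : LinearMap.ker (LinearMap.lsmul R E s) = ⊥ := by
    by_contra h
    refine hess _ h ((Submodule.eq_bot_iff _).mpr ?_)
    rintro _ ⟨hy, a, rfl⟩
    have hsa : s • a = 0 := hι (by rw [map_smul, map_zero]; exact hy)
    rw [Algebra.smul_def, mul_eq_zero, Ideal.Quotient.algebraMap_eq,
      Ideal.Quotient.eq_zero_iff_mem] at hsa
    rw [hsa.resolve_left hs, map_zero]
  exact (Submodule.mem_bot R).mp (hker ▸ hx)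

/-- For `q ≤ p` there is a nonzero map `κ(q) → E` whenever `R ⧸ p` embeds in the injective
module `E`. -/
lemma exists_linearMap_residueField_ne_zero {R : Type u} [CommRing R] {p q : Ideal R}
    [p.IsPrime] [q.IsPrime] (hqp : q ≤ p) {E : Type u} [AddCommGroup E] [Module R E]
    [Module.Injective R E] (ι : (R ⧸ p) →ₗ[R] E) (hι : Function.Injective ι) :
    ∃ f : IsLocalRing.ResidueField (Localization.AtPrime q) →ₗ[R] E, f ≠ 0 := by
  obtain ⟨f, hf⟩ := Module.Injective.out
    (Algebra.linearMap (R ⧸ q) q.ResidueField |>.restrictScalars R)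
    q.injective_algebraMap_quotient_residueField (ι ∘ₗ Submodule.factor hqp)
  refine ⟨f, fun h ↦ one_ne_zero (α := R ⧸ p) (hι ?_)⟩
  simpa [h] using (hf 1).symm

/-!
STATEMENT 17: Let `R` be commutative noetherian of finite Krull dimension, `p` a prime
of `R`, and `E` an injective hull of `R/p`: an injective `R`-module together with an
injective `R`-linear map `ι : R/p → E` whose image is an essential submodule of `E`
(every nonzero submodule of `E` meets it nontrivially).  Then the cosupport of `E` is
`{q ∈ Spec R : q ⊆ p}`.
-/
theorem cosupport_injective_hull (R : Type u) [CommRing R] [IsNoetherianRing R]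
    (hdim : ringKrullDim R < ⊤) (p : PrimeSpectrum R)
    (E : Type u) [AddCommGroup E] [Module R E] [Module.Injective R E]
    (ι : (R ⧸ p.asIdeal) →ₗ[R] E) (hι : Function.Injective ι)
    (hess : ∀ N : Submodule R E, N ≠ ⊥ → N ⊓ LinearMap.range ι ≠ ⊥) :
    ∀ q : PrimeSpectrum R,
      q ∈ moduleCosupport R E ↔ q.asIdeal ≤ p.asIdeal := by
  intro q
  rw [mem_moduleCosupport_iff_of_injective]
  refine ⟨fun ⟨f, hf⟩ s hsq ↦ ?_, fun h ↦ exists_linearMap_residueField_ne_zero h ι hι⟩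
  by_contra hsp
  refine hf (LinearMap.ext fun x ↦ eq_zero_of_smul_eq_zero_of_essential ι hι hess hsp ?_)
  have hs : algebraMap R q.asIdeal.ResidueField s = 0 :=
    Ideal.algebraMap_residueField_eq_zero.mpr hsq
  rw [← map_smul, Algebra.smul_def, hs, zero_mul, map_zero]
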